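/- arXiv:2402.03982 — 8 statements merged into one kernel-verified Lean document; each statement's English description precedes it below -/
import Mathlib

section
/- Let (α_s)_{s≥1} be a real sequence, 0 ≤ β1 < β2 ≤ 1 and ε > 0. Define ζ_s = Σ_{j=1}^s β1^{s−j} α_j, γ_s = (1/(1−β1^s))·Σ_{j=1}^s β1^{s−j} α_j, and θ_s = Σ_{j=1}^s β2^{s−j} α_j². Then for every t ≥ 1: Σ_{s=1}^t ζ_s²/(ε+θ_s) ≤ (1/((1−β1)(1−β1/β2)))·( log(1 + θ_t/ε) − t·log β2 ), and Σ_{s=1}^t γ_s²/(ε+θ_s) ≤ (1/((1−β1)²(1−β1/β2)))·( log(1 + θ_t/ε) − t·log β2 ). -/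
/-- Recursion satisfied by the exponentially weighted sums `∑ b ^ (n - j) * f j`. -/
theorem sum_Icc_pow_sub_mul_succ (b : ℝ) (f : ℕ → ℝ) (n : ℕ) :
    ∑ j ∈ Finset.Icc 1 (n + 1), b ^ (n + 1 - j) * f j =
      b * ∑ j ∈ Finset.Icc 1 n, b ^ (n - j) * f j + f (n + 1) := by
  rw [Finset.sum_Icc_succ_top (by lia), Finset.mul_sum]
  congr 1
  · refine Finset.sum_congr rfl fun j hj => ?_
    rw [Nat.succ_sub (Finset.mem_Icc.1 hj).2, pow_succ]
    ring
  · simp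

/-- Geometric sum with reversed exponents. -/
theorem one_sub_mul_sum_Icc_pow_sub (b : ℝ) (n : ℕ) :
    (1 - b) * ∑ j ∈ Finset.Icc 1 n, b ^ (n - j) = 1 - b ^ n := by
  induction n with
  | zero => simp
  | succ n ih =>
    have h := sum_Icc_pow_sub_mul_succ b (fun _ => 1) n
    simp only [mul_one] at h
    rw [h, pow_succ]
    linear_combination b * ih

/-- Cauchy–Schwarz for exponentially weighted sums. -/
theorem one_sub_mul_sq_sum_Icc_pow_sub_le {b : ℝ} (hb : 0 ≤ b) (hb1 : b ≤ 1) (α : ℕ → ℝ) (n : ℕ) :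
    (1 - b) * (∑ j ∈ Finset.Icc 1 n, b ^ (n - j) * α j) ^ 2 ≤
      (1 - b ^ n) * ∑ j ∈ Finset.Icc 1 n, b ^ (n - j) * α j ^ 2 := by
  rw [← one_sub_mul_sum_Icc_pow_sub, mul_assoc]
  refine mul_le_mul_of_nonneg_left ?_ (sub_nonneg.2 hb1)
  exact Finset.sum_sq_le_sum_mul_sum_of_sq_le_mul _ (fun j _ => by positivity)
    (fun j _ => by positivity) (fun j _ => (by ring : _ = _).le)

/-- If `Z` and `θ` are driven by the same increments `a` with decay rates
`b` and `c`, the ratios `Z / (ε + θ)` sum to at most a logarithmic potential. -/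
theorem sum_div_add_le_log {b c ε : ℝ} (hb : 0 ≤ b) (hc : 0 < c) (hc1 : c ≤ 1)
    (hε : 0 < ε) {a Z θ : ℕ → ℝ} (ha : ∀ n, 0 ≤ a n) (hZ0 : Z 0 = 0) (hθ0 : θ 0 = 0)
    (hZ : ∀ n, Z (n + 1) = b * Z n + a (n + 1)) (hθ : ∀ n, θ (n + 1) = c * θ n + a (n + 1))
    (t : ℕ) :
    (1 - b / c) * ∑ s ∈ Finset.Icc 1 t, Z s / (ε + θ s) ≤
      Real.log (1 + θ t / ε) - t * Real.log c := by
  have hZnn : ∀ n, 0 ≤ Z n := fun n => by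
    induction n with
    | zero => exact hZ0.ge
    | succ n ih => rw [hZ]; have := ha (n + 1); positivity
  have hθnn : ∀ n, 0 ≤ θ n := fun n => by
    induction n with
    | zero => exact hθ0.ge
    | succ n ih => rw [hθ]; have := ha (n + 1); positivity
  have hD : ∀ n, 0 < ε + θ n := fun n => add_pos_of_pos_of_nonneg hε (hθnn n)
  have key : ∀ n, (1 - b / c) * ∑ s ∈ Finset.Icc 1 n, Z s / (ε + θ s) + b / c * (Z n / (ε + θ n))
      ≤ Real.log (ε + θ n) - Real.log ε - n * Real.log c := fun n => by
    induction n with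
    | zero => simp [hZ0, hθ0]
    | succ n ih =>
      have hDc : 0 < c * (ε + θ n) := mul_pos hc (hD n)
      have hgap : c * (ε + θ n) + a (n + 1) ≤ ε + θ (n + 1) := by
        rw [hθ]; nlinarith
      have hratio : Z (n + 1) / (ε + θ (n + 1)) ≤
          b / c * (Z n / (ε + θ n)) + a (n + 1) / (ε + θ (n + 1)) := by
        rw [hZ, add_div, div_mul_div_comm]
        gcongr
        · exact mul_nonneg hb (hZnn n)
        · linarith [ha (n + 1)]
      have hlog := Real.one_sub_inv_le_log_of_pos (div_pos (hD (n + 1)) hDc)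
      rw [Real.log_div (hD _).ne' hDc.ne', Real.log_mul hc.ne' (hD n).ne', inv_div] at hlog
      have hinc : a (n + 1) / (ε + θ (n + 1)) ≤ 1 - c * (ε + θ n) / (ε + θ (n + 1)) := by
        rw [le_sub_iff_add_le, ← add_div, div_le_one (hD _)]
        linarith
      rw [Finset.sum_Icc_succ_top (by lia)]
      push_cast
      linarith
  have hlog : Real.log (1 + θ t / ε) = Real.log (ε + θ t) - Real.log ε := by
    rw [← Real.log_div (hD t).ne' hε.ne', add_div, div_self hε.ne']
  rw [hlog]
  have := mul_nonneg (div_nonneg hb hc.le) (div_nonneg (hZnn t) (hD t).le)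
  linarith [key t]

theorem stmt_4
    (α : ℕ → ℝ) (β1 β2 ε : ℝ)
    (hβ1 : 0 ≤ β1) (hβ12 : β1 < β2) (hβ2 : β2 ≤ 1) (hε : 0 < ε)
    (ζ γ θ : ℕ → ℝ)
    (hζ : ∀ s, ζ s = ∑ j ∈ Finset.Icc 1 s, β1 ^ (s - j) * α j)
    (hγ : ∀ s, γ s = (1 / (1 - β1 ^ s)) * ∑ j ∈ Finset.Icc 1 s, β1 ^ (s - j) * α j)
    (hθ : ∀ s, θ s = ∑ j ∈ Finset.Icc 1 s, β2 ^ (s - j) * (α j) ^ 2)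
    (t : ℕ) (ht : 1 ≤ t) :
    (∑ s ∈ Finset.Icc 1 t, (ζ s) ^ 2 / (ε + θ s) ≤
      (1 / ((1 - β1) * (1 - β1 / β2))) * (Real.log (1 + θ t / ε) - t * Real.log β2)) ∧
    (∑ s ∈ Finset.Icc 1 t, (γ s) ^ 2 / (ε + θ s) ≤
      (1 / ((1 - β1) ^ 2 * (1 - β1 / β2))) * (Real.log (1 + θ t / ε) - t * Real.log β2)) := by
  have hc : 0 < β2 := hβ1.trans_lt hβ12
  have hb1 : 0 < 1 - β1 := by linarith
  have hr : 0 < 1 - β1 / β2 := by rwa [sub_pos, div_lt_one hc]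
  set Z : ℕ → ℝ := fun s => ∑ j ∈ Finset.Icc 1 s, β1 ^ (s - j) * α j ^ 2 with hZ
  have hmain := sum_div_add_le_log hβ1 hc hβ2 hε (a := fun j => α j ^ 2) (Z := Z) (θ := θ)
    (fun j => sq_nonneg _) (by simp [hZ]) (by simp [hθ])
    (fun n => sum_Icc_pow_sub_mul_succ β1 (fun j => α j ^ 2) n)
    (fun n => by rw [hθ, hθ]; exact sum_Icc_pow_sub_mul_succ β2 (fun j => α j ^ 2) n) t
  have hθnn : ∀ s, 0 ≤ θ s := fun s => by
    rw [hθ]; exact Finset.sum_nonneg fun j _ => by positivity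
  have hZnn : ∀ s, 0 ≤ Z s := fun s => Finset.sum_nonneg fun j _ => by positivity
  have hcs : ∀ s, (1 - β1) * ζ s ^ 2 ≤ (1 - β1 ^ s) * Z s := fun s => by
    rw [hζ]; exact one_sub_mul_sq_sum_Icc_pow_sub_le hβ1 (by linarith) α s
  have hsum : ∀ (k : ℝ) (x : ℕ → ℝ), 0 < k → (∀ s ∈ Finset.Icc 1 t, k * x s ^ 2 ≤ Z s) →
      ∑ s ∈ Finset.Icc 1 t, x s ^ 2 / (ε + θ s) ≤
        (1 / (k * (1 - β1 / β2))) * (Real.log (1 + θ t / ε) - t * Real.log β2) := by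
    intro k x hk hx
    rw [one_div_mul_eq_div, le_div_iff₀ (mul_pos hk hr)]
    refine le_trans ?_ hmain
    rw [mul_comm, mul_comm k, mul_assoc, Finset.mul_sum]
    refine mul_le_mul_of_nonneg_left (Finset.sum_le_sum fun s hs => ?_) hr.le
    rw [← mul_div_assoc]
    exact div_le_div_of_nonneg_right (hx s hs) (add_nonneg hε.le (hθnn s))
  refine ⟨hsum _ ζ hb1 fun s _ => ?_, hsum _ γ (by positivity) fun s hs => ?_⟩
  · refine (hcs s).trans (mul_le_of_le_one_left (hZnn s) ?_)
    linarith [pow_nonneg hβ1 s]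
  · have hs1 : 1 ≤ s := (Finset.mem_Icc.1 hs).1
    have hpow : β1 ^ s ≤ β1 := pow_le_of_le_one hβ1 (by linarith) (by lia)
    have hq : 0 < 1 - β1 ^ s := by linarith
    have hγζ : ζ s = (1 - β1 ^ s) * γ s := by
      rw [hγ, ← hζ]; field_simp
    have h := hcs s
    rw [hγζ, mul_pow] at h
    have h' : (1 - β1) * ((1 - β1 ^ s) * γ s ^ 2) ≤ Z s :=
      le_of_mul_le_mul_left (by linarith) hq
    refine le_trans ?_ h'
    rw [sq (1 - β1), mul_assoc]
    gcongr
end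

section
/- For the Adam iterates with 0 ≤ β1 < 1 and 0 < β2 < 1, for every s ≥ 2 and every coordinate i ∈ [d]: | η_s·b_{s−1,i}/(η_{s−1}·b_{s,i}) − 1 | ≤ Σ_max, where Σ_max := max{1, √((1+β2)/β2) − 1}. -/
/-- Consecutive bias-correction factors `√(1 - β ^ s)` differ by at most a factor `√(1 + β)`. -/
theorem sqrt_one_sub_pow_succ_le {β : ℝ} (hβ : 0 ≤ β) (hβ' : β ≤ 1) {n : ℕ} (hn : n ≠ 0) :
    √(1 - β ^ (n + 1)) ≤ √(1 + β) * √(1 - β ^ n) := by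
  rw [← Real.sqrt_mul (by positivity)]
  apply Real.sqrt_le_sqrt
  have h : β ^ n ≤ β := pow_le_of_le_one hβ hβ' hn
  rw [pow_succ]
  linarith

/-- The bias-corrected step sizes of Adam grow by at most a factor `√(1 + β₂)` per step. -/
theorem adam_stepsize_succ_le {β₁ β₂ η : ℝ} (hβ₁ : 0 ≤ β₁) (hβ₁' : β₁ < 1)
    (hβ₂ : 0 ≤ β₂) (hβ₂' : β₂ ≤ 1) (hη : 0 ≤ η) {n : ℕ} (hn : n ≠ 0) :
    η * √(1 - β₂ ^ (n + 1)) / (1 - β₁ ^ (n + 1)) ≤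
      √(1 + β₂) * (η * √(1 - β₂ ^ n) / (1 - β₁ ^ n)) := by
  have hn1 : 0 < 1 - β₁ ^ n := sub_pos.2 (pow_lt_one₀ hβ₁ hβ₁' hn)
  have hle : 1 - β₁ ^ n ≤ 1 - β₁ ^ (n + 1) :=
    sub_le_sub_left (pow_le_pow_of_le_one hβ₁ hβ₁'.le n.le_succ) 1
  calc η * √(1 - β₂ ^ (n + 1)) / (1 - β₁ ^ (n + 1))
      ≤ η * (√(1 + β₂) * √(1 - β₂ ^ n)) / (1 - β₁ ^ n) := by
        gcongr
        exact sqrt_one_sub_pow_succ_le hβ₂ hβ₂' hn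
    _ = √(1 + β₂) * (η * √(1 - β₂ ^ n) / (1 - β₁ ^ n)) := by ring

/-- The Adam preconditioner shrinks by at most a factor `√β` per step. -/
theorem sqrt_mul_adam_precond_le {β ε v w : ℝ} (hβ : 0 ≤ β) (hβ' : β ≤ 1) (hε : 0 ≤ ε)
    (hvw : β * v ≤ w) (n : ℕ) :
    √β * (√v + ε * √(1 - β ^ n)) ≤ √w + ε * √(1 - β ^ (n + 1)) := by
  have h₁ : √β * √v ≤ √w := by
    rw [← Real.sqrt_mul hβ]
    exact Real.sqrt_le_sqrt hvw
  have h₂ : √β * √(1 - β ^ n) ≤ √(1 - β ^ (n + 1)) := by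
    rw [← Real.sqrt_mul hβ]
    apply Real.sqrt_le_sqrt
    rw [pow_succ]
    linarith
  linarith [mul_le_mul_of_nonneg_left h₂ hε]


theorem stmt_5
    (d T : ℕ) (hd : 1 ≤ d) (hT : 1 ≤ T)
    (β1 β2 η ε : ℝ)
    (hβ1 : 0 ≤ β1) (hβ1' : β1 < 1) (hβ2 : 0 < β2) (hβ2' : β2 < 1)
    (hη : 0 < η) (hε : 0 < ε)
    (g m v x : ℕ → EuclideanSpace ℝ (Fin d))
    (hm0 : m 0 = 0) (hv0 : v 0 = 0)
    (hm : ∀ s, 1 ≤ s → ∀ i, m s i = β1 * m (s - 1) i + (1 - β1) * g s i)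
    (hv : ∀ s, 1 ≤ s → ∀ i, v s i = β2 * v (s - 1) i + (1 - β2) * (g s i) ^ 2)
    (ηs : ℕ → ℝ) (hηs : ∀ s, 1 ≤ s → ηs s = η * Real.sqrt (1 - β2 ^ s) / (1 - β1 ^ s))
    (b : ℕ → Fin d → ℝ)
    (hb : ∀ s i, b s i = Real.sqrt (v s i) + ε * Real.sqrt (1 - β2 ^ s))
    (hx : ∀ s, 1 ≤ s → ∀ i, x (s + 1) i = x s i - ηs s * m s i / b s i) :
    ∀ s, 2 ≤ s → ∀ i : Fin d,
      |ηs s * b (s - 1) i / (ηs (s - 1) * b s i) - 1| ≤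
        max 1 (Real.sqrt ((1 + β2) / β2) - 1) := by
  intro s hs i
  obtain ⟨n, rfl⟩ : ∃ n, s = n + 1 := ⟨s - 1, by omega⟩
  have hn : n ≠ 0 := by omega
  have hη_pos : ∀ k, k ≠ 0 → 0 < ηs k := fun k hk ↦ by
    have h₁ : 0 < 1 - β1 ^ k := sub_pos.2 (pow_lt_one₀ hβ1 hβ1' hk)
    have h₂ : 0 < 1 - β2 ^ k := sub_pos.2 (pow_lt_one₀ hβ2.le hβ2' hk)
    rw [hηs k (Nat.one_le_iff_ne_zero.2 hk)]
    positivity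
  have hb_pos : ∀ k, k ≠ 0 → 0 < b k i := fun k hk ↦ by
    have h : 0 < 1 - β2 ^ k := sub_pos.2 (pow_lt_one₀ hβ2.le hβ2' hk)
    rw [hb]
    positivity
  have hη_le : ηs (n + 1) ≤ √(1 + β2) * ηs n := by
    rw [hηs _ (by omega), hηs n (by omega)]
    exact adam_stepsize_succ_le hβ1 hβ1' hβ2.le hβ2'.le hη.le hn
  have hb_le : √β2 * b n i ≤ b (n + 1) i := by
    rw [hb, hb]
    refine sqrt_mul_adam_precond_le hβ2.le hβ2'.le hε.le ?_ n
    rw [hv (n + 1) (by omega), Nat.add_sub_cancel]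
    exact le_add_of_nonneg_right (mul_nonneg (sub_nonneg.2 hβ2'.le) (sq_nonneg _))
  have hηn := hη_pos n hn
  have hηn' := hη_pos (n + 1) n.succ_ne_zero
  have hbn := hb_pos n hn
  have hbn' := hb_pos (n + 1) n.succ_ne_zero
  have hβ_pos : 0 < √β2 := Real.sqrt_pos.2 hβ2
  rw [Nat.add_sub_cancel]
  have h_nonneg : 0 ≤ ηs (n + 1) * b n i / (ηs n * b (n + 1) i) := by positivity
  have h_le : ηs (n + 1) * b n i / (ηs n * b (n + 1) i) ≤ √((1 + β2) / β2) := by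
    rw [Real.sqrt_div (by positivity), div_le_div_iff₀ (by positivity) hβ_pos]
    calc ηs (n + 1) * b n i * √β2 = ηs (n + 1) * (√β2 * b n i) := by ring
      _ ≤ √(1 + β2) * ηs n * b (n + 1) i := by gcongr
      _ = √(1 + β2) * (ηs n * b (n + 1) i) := by ring
  rw [abs_le]
  constructor
  · linarith [le_max_left 1 (√((1 + β2) / β2) - 1)]
  · exact (sub_le_sub_right h_le 1).trans (le_max_right _ _)
end

section
/- For the Adam iterates with 0 ≤ β1 < β2 < 1, for every s ≥ 1 and every coordinate i ∈ [d]: | m_{s,i}/b_{s,i} | ≤ √( (1−β1)(1−β1^s) / ((1−β2)(1−β1/β2)) ). -/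
/-- Cauchy-Schwarz for two weighted terms: if `m ^ 2 ≤ A * V` and the weights `p`, `q` are
nonnegative, then `(p * m + q * g) ^ 2 ≤ (p * A + q) * (p * V + q * g ^ 2)`. -/
theorem sq_weighted_add_le {p q A V m g : ℝ} (hp : 0 ≤ p) (hq : 0 ≤ q) (hA : 0 ≤ A) (hV : 0 ≤ V)
    (h : m ^ 2 ≤ A * V) :
    (p * m + q * g) ^ 2 ≤ (p * A + q) * (p * V + q * g ^ 2) := by
  have hcross : 2 * (m * g) ≤ V + A * g ^ 2 := by
    refine le_of_abs_le (abs_le_of_sq_le_sq ?_ (by positivity))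
    nlinarith [sq_nonneg (V - A * g ^ 2), mul_le_mul_of_nonneg_right h (sq_nonneg g)]
  nlinarith [mul_le_mul_of_nonneg_left hcross (mul_nonneg hp hq),
    mul_le_mul_of_nonneg_left h (sq_nonneg p)]

/-- The squared exponential moving average of a real sequence is controlled by the exponential
moving average of its squares, when the latter has the larger decay parameter. -/
theorem sq_movingAverage_le {β1 β2 : ℝ} (hβ1 : 0 ≤ β1) (hβ12 : β1 ≤ β2) (hβ2 : β2 < 1)
    {g m v : ℕ → ℝ} (hm0 : m 0 = 0) (hv0 : v 0 = 0)
    (hm : ∀ s, m (s + 1) = β1 * m s + (1 - β1) * g (s + 1))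
    (hv : ∀ s, v (s + 1) = β2 * v s + (1 - β2) * g (s + 1) ^ 2) (s : ℕ) :
    0 ≤ v s ∧ m s ^ 2 ≤ (1 - β1 ^ s) * ((1 - β1) / (1 - β2) * v s) := by
  have h1 : 0 < 1 - β1 := by linarith
  have h2 : 0 < 1 - β2 := by linarith
  have hβ2_nonneg : 0 ≤ β2 := hβ1.trans hβ12
  induction s with
  | zero => simp [hm0, hv0]
  | succ s ih =>
    obtain ⟨hvs, hms⟩ := ih
    have hA : 0 ≤ 1 - β1 ^ s := sub_nonneg.2 (pow_le_one₀ hβ1 (by linarith))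
    have hA' : 0 ≤ 1 - β1 ^ (s + 1) := sub_nonneg.2 (pow_le_one₀ hβ1 (by linarith))
    have hV : 0 ≤ (1 - β1) / (1 - β2) * v s := by positivity
    refine ⟨by rw [hv]; positivity, ?_⟩
    calc m (s + 1) ^ 2
        ≤ (β1 * (1 - β1 ^ s) + (1 - β1)) *
            (β1 * ((1 - β1) / (1 - β2) * v s) + (1 - β1) * g (s + 1) ^ 2) := by
          rw [hm]
          exact sq_weighted_add_le hβ1 h1.le hA hV hms
      _ = (1 - β1 ^ (s + 1)) *
            (β1 * ((1 - β1) / (1 - β2) * v s) + (1 - β1) * g (s + 1) ^ 2) := by ring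
      _ ≤ (1 - β1 ^ (s + 1)) *
            (β2 * ((1 - β1) / (1 - β2) * v s) + (1 - β1) * g (s + 1) ^ 2) := by gcongr
      _ = (1 - β1 ^ (s + 1)) * ((1 - β1) / (1 - β2) * v (s + 1)) := by
          rw [hv]
          field_simp


theorem stmt_6
    (d T : ℕ) (hd : 1 ≤ d) (hT : 1 ≤ T)
    (β1 β2 η ε : ℝ)
    (hβ1 : 0 ≤ β1) (hβ12 : β1 < β2) (hβ2 : β2 < 1)
    (hη : 0 < η) (hε : 0 < ε)
    (g m v x : ℕ → EuclideanSpace ℝ (Fin d))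
    (hm0 : m 0 = 0) (hv0 : v 0 = 0)
    (hm : ∀ s, 1 ≤ s → ∀ i, m s i = β1 * m (s - 1) i + (1 - β1) * g s i)
    (hv : ∀ s, 1 ≤ s → ∀ i, v s i = β2 * v (s - 1) i + (1 - β2) * (g s i) ^ 2)
    (ηs : ℕ → ℝ) (hηs : ∀ s, 1 ≤ s → ηs s = η * Real.sqrt (1 - β2 ^ s) / (1 - β1 ^ s))
    (b : ℕ → Fin d → ℝ)
    (hb : ∀ s i, b s i = Real.sqrt (v s i) + ε * Real.sqrt (1 - β2 ^ s))
    (hx : ∀ s, 1 ≤ s → ∀ i, x (s + 1) i = x s i - ηs s * m s i / b s i) :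
    ∀ s, 1 ≤ s → ∀ i : Fin d,
      |m s i / b s i| ≤
        Real.sqrt ((1 - β1) * (1 - β1 ^ s) / ((1 - β2) * (1 - β1 / β2))) := by
  intro s hs i
  obtain ⟨hv_nonneg, hmv⟩ := sq_movingAverage_le (g := fun k => g k i) (m := fun k => m k i)
    (v := fun k => v k i) hβ1 hβ12.le hβ2 (by simp [hm0]) (by simp [hv0])
    (fun k => hm (k + 1) (by omega) i) (fun k => hv (k + 1) (by omega) i) s
  have hβ2_pos : 0 < β2 := hβ1.trans_lt hβ12
  have h1 : 0 < 1 - β1 := by linarith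
  have h2 : 0 < 1 - β2 := by linarith
  have hA : 0 ≤ 1 - β1 ^ s := sub_nonneg.2 (pow_le_one₀ hβ1 (by linarith))
  have hratio : 0 < 1 - β1 / β2 := sub_pos.2 ((div_lt_one hβ2_pos).2 hβ12)
  have hratio_le : 1 - β1 / β2 ≤ 1 := sub_le_self _ (by positivity)
  have hcorr : 0 < 1 - β2 ^ s := sub_pos.2 (pow_lt_one₀ hβ2_pos.le hβ2 (by omega))
  have hb_pos : 0 < b s i := by rw [hb]; positivity
  have hvb : √(v s i) ≤ b s i := by
    rw [hb]
    exact le_add_of_nonneg_right (by positivity)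
  set K := (1 - β1) * (1 - β1 ^ s) / ((1 - β2) * (1 - β1 / β2)) with hK
  have hK_ge : (1 - β1 ^ s) * ((1 - β1) / (1 - β2)) ≤ K := by
    rw [hK, ← mul_div_assoc, mul_comm (1 - β1 ^ s)]
    exact div_le_div_of_nonneg_left (by positivity) (by positivity)
      (mul_le_of_le_one_right h2.le hratio_le)
  have hK_nonneg : 0 ≤ K := by positivity
  rw [abs_div, abs_of_pos hb_pos, div_le_iff₀ hb_pos]
  calc |m s i| ≤ √(K * v s i) := by
        apply Real.abs_le_sqrt
        calc m s i ^ 2 ≤ (1 - β1 ^ s) * ((1 - β1) / (1 - β2)) * v s i := by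
              rw [mul_assoc]
              exact hmv
          _ ≤ K * v s i := by gcongr
    _ = √K * √(v s i) := Real.sqrt_mul hK_nonneg _
    _ ≤ √K * b s i := by gcongr
end

section
/- For the Adam iterates with 0 ≤ β1 < β2 < 1 and step-size η = C0·√(1−β2) for a constant C0 > 0, if f is L-smooth then for every s ≥ 1: ‖∇f(x_s)‖ ≤ ‖∇f(x_1)‖ + L·C0·s·√( d/(1−β1/β2) ). -/
/-- The square of Adam's first moment (coordinate-wise) is controlled by its second moment. -/
theorem adam_first_moment_sq_le {β1 β2 : ℝ} (hβ1 : 0 ≤ β1) (hβ12 : β1 ≤ β2) (hβ2 : β2 < 1)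
    {g m v : ℕ → ℝ} (hm0 : m 0 = 0) (hv0 : v 0 = 0)
    (hm : ∀ s, m (s + 1) = β1 * m s + (1 - β1) * g (s + 1))
    (hv : ∀ s, v (s + 1) = β2 * v s + (1 - β2) * g (s + 1) ^ 2) (s : ℕ) :
    0 ≤ v s ∧ (1 - β2) * m s ^ 2 ≤ (1 - β1 ^ s) * ((1 - β1) * v s) := by
  induction s with
  | zero => simp [hm0, hv0]
  | succ s ih =>
    obtain ⟨hvs, hms⟩ := ih
    have hc : 0 < 1 - β2 := by linarith
    have ha : 0 ≤ 1 - β1 := by linarith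
    have hA : 0 ≤ 1 - β1 ^ s := sub_nonneg.2 (pow_le_one₀ hβ1 (by linarith))
    refine ⟨by rw [hv]; have := hβ1.trans hβ12; positivity, ?_⟩
    rw [hm, hv, pow_succ β1]
    set G := g (s + 1)
    set A := 1 - β1 ^ s with hAdef
    have hpow : β1 ^ s = 1 - A := by rw [hAdef]; ring
    rw [hpow]
    set w := (1 - β1) * v s
    have hw : 0 ≤ w := mul_nonneg ha hvs
    have hcross : 2 * (1 - β2) * (m s * G) ≤ (1 - β2) * A * G ^ 2 + w := by
      refine (abs_le_of_sq_le_sq' ?_ (by positivity)).2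
      have := mul_le_mul_of_nonneg_left hms (by positivity : 0 ≤ 4 * (1 - β2) * G ^ 2)
      nlinarith [sq_nonneg ((1 - β2) * A * G ^ 2 - w)]
    have hcross' := mul_le_mul_of_nonneg_left hcross (mul_nonneg hβ1 ha)
    have hms' := mul_le_mul_of_nonneg_left hms (sq_nonneg β1)
    have hB : 0 ≤ β1 * A + (1 - β1) := by positivity
    have hβw : β1 * w ≤ β2 * w := mul_le_mul_of_nonneg_right hβ12 hw
    calc (1 - β2) * (β1 * m s + (1 - β1) * G) ^ 2
        ≤ (β1 * A + (1 - β1)) * (β1 * w + (1 - β1) * (1 - β2) * G ^ 2) := by linarith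
      _ ≤ (β1 * A + (1 - β1)) * (β2 * w + (1 - β1) * (1 - β2) * G ^ 2) := by gcongr
      _ = _ := by ring

/-- Each coordinate of an Adam step with `η = C0 √(1 - β2)` is at most `C0` in absolute value. -/
theorem adam_step_abs_le {β1 β2 C0 ε m v : ℝ} {s : ℕ} (hs : s ≠ 0) (hβ1 : 0 ≤ β1)
    (hβ12 : β1 ≤ β2) (hβ2 : β2 < 1) (hC0 : 0 ≤ C0) (hε : 0 < ε) (hv : 0 ≤ v)
    (hmv : (1 - β2) * m ^ 2 ≤ (1 - β1 ^ s) * ((1 - β1) * v)) :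
    |C0 * √(1 - β2) * √(1 - β2 ^ s) / (1 - β1 ^ s) * m / (√v + ε * √(1 - β2 ^ s))| ≤ C0 := by
  have hβ2' : 0 ≤ β2 := hβ1.trans hβ12
  have hD : 0 < 1 - β2 ^ s := sub_pos.2 (pow_lt_one₀ hβ2' hβ2 hs)
  have hA : 0 < 1 - β1 ^ s := sub_pos.2 (pow_lt_one₀ hβ1 (by linarith) hs)
  have hAβ : 1 - β1 ≤ 1 - β1 ^ s :=
    sub_le_sub_left (pow_le_of_le_one hβ1 (by linarith) hs) 1
  have hc : 0 ≤ 1 - β2 := by linarith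
  have hDs : 0 < √(1 - β2 ^ s) := Real.sqrt_pos.2 hD
  have hb : 0 < √v + ε * √(1 - β2 ^ s) := by positivity
  have key : √(1 - β2) * √(1 - β2 ^ s) * |m| ≤ (1 - β1 ^ s) * √v := by
    refine (abs_le_of_sq_le_sq' ?_ (by positivity)).2
    rw [mul_pow, mul_pow, mul_pow, sq_abs, Real.sq_sqrt hc, Real.sq_sqrt hD.le, Real.sq_sqrt hv]
    calc (1 - β2) * (1 - β2 ^ s) * m ^ 2 ≤ (1 - β2) * 1 * m ^ 2 := by
          gcongr; linarith [pow_nonneg hβ2' s]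
      _ ≤ (1 - β1 ^ s) * ((1 - β1) * v) := by linarith
      _ ≤ (1 - β1 ^ s) * ((1 - β1 ^ s) * v) := by gcongr
      _ = _ := by ring
  rw [abs_div, abs_mul, abs_of_pos hb, abs_of_nonneg (by positivity), div_le_iff₀ hb,
    div_mul_eq_mul_div, div_le_iff₀ hA]
  calc C0 * √(1 - β2) * √(1 - β2 ^ s) * |m|
      = C0 * (√(1 - β2) * √(1 - β2 ^ s) * |m|) := by ring
    _ ≤ C0 * ((1 - β1 ^ s) * (√v + ε * √(1 - β2 ^ s))) := by
      refine mul_le_mul_of_nonneg_left (key.trans ?_) hC0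
      gcongr
      linarith [mul_pos hε hDs]
    _ = _ := by ring

theorem EuclideanSpace.norm_le_mul_sqrt_card {ι : Type*} [Fintype ι] {C : ℝ} (hC : 0 ≤ C)
    {y : EuclideanSpace ℝ ι} (hy : ∀ i, |y i| ≤ C) : ‖y‖ ≤ C * √(Fintype.card ι) := by
  rw [EuclideanSpace.norm_eq, ← Real.sqrt_sq hC, ← Real.sqrt_mul (sq_nonneg C)]
  refine Real.sqrt_le_sqrt ((Finset.sum_le_card_nsmul Finset.univ _ (C ^ 2) fun i _ => ?_).trans ?_)
  · rw [Real.norm_eq_abs]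
    exact pow_le_pow_left₀ (abs_nonneg _) (hy i) 2
  · simp [mul_comm]


theorem stmt_7
    (d T : ℕ) (hd : 1 ≤ d) (hT : 1 ≤ T)
    (β1 β2 η ε : ℝ)
    (hβ1 : 0 ≤ β1) (hβ12 : β1 < β2) (hβ2 : β2 < 1)
    (hη : 0 < η) (hε : 0 < ε)
    (C0 : ℝ) (hC0 : 0 < C0) (hηC0 : η = C0 * Real.sqrt (1 - β2))
    (f : EuclideanSpace ℝ (Fin d) → ℝ) (L : ℝ)
    (hdiff : Differentiable ℝ f)
    (hsmooth : ∀ y z : EuclideanSpace ℝ (Fin d),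
      ‖gradient f y - gradient f z‖ ≤ L * ‖y - z‖)
    (g m v x : ℕ → EuclideanSpace ℝ (Fin d))
    (hm0 : m 0 = 0) (hv0 : v 0 = 0)
    (hm : ∀ s, 1 ≤ s → ∀ i, m s i = β1 * m (s - 1) i + (1 - β1) * g s i)
    (hv : ∀ s, 1 ≤ s → ∀ i, v s i = β2 * v (s - 1) i + (1 - β2) * (g s i) ^ 2)
    (ηs : ℕ → ℝ) (hηs : ∀ s, 1 ≤ s → ηs s = η * Real.sqrt (1 - β2 ^ s) / (1 - β1 ^ s))
    (b : ℕ → Fin d → ℝ)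
    (hb : ∀ s i, b s i = Real.sqrt (v s i) + ε * Real.sqrt (1 - β2 ^ s))
    (hx : ∀ s, 1 ≤ s → ∀ i, x (s + 1) i = x s i - ηs s * m s i / b s i) :
    ∀ s : ℕ, 1 ≤ s →
      ‖gradient f (x s)‖ ≤
        ‖gradient f (x 1)‖ + L * C0 * s * Real.sqrt (d / (1 - β1 / β2)) := by
  have hL : 0 ≤ L := by
    have : Nonempty (Fin d) := ⟨⟨0, hd⟩⟩
    obtain ⟨y, hy⟩ := exists_ne (0 : EuclideanSpace ℝ (Fin d))
    have := (norm_nonneg _).trans (hsmooth y 0)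
    rw [sub_zero] at this
    exact nonneg_of_mul_nonneg_left this (norm_pos_iff.2 hy)
  have hstep : ∀ s, 1 ≤ s → ‖x (s + 1) - x s‖ ≤ C0 * √(d / (1 - β1 / β2)) := by
    intro s hs
    have hcoord : ∀ i, |(x (s + 1) - x s) i| ≤ C0 := by
      intro i
      obtain ⟨hvs, hmv⟩ := adam_first_moment_sq_le (g := fun s => g s i) (m := fun s => m s i)
        (v := fun s => v s i) hβ1 hβ12.le hβ2 (by simp [hm0]) (by simp [hv0])
        (fun s => hm (s + 1) s.succ_pos i) (fun s => hv (s + 1) s.succ_pos i) s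
      rw [PiLp.sub_apply, hx s hs, sub_sub_cancel_left, abs_neg, hηs s hs, hb, hηC0]
      exact adam_step_abs_le (by omega) hβ1 hβ12.le hβ2 hC0.le hε hvs hmv
    refine (EuclideanSpace.norm_le_mul_sqrt_card hC0.le hcoord).trans ?_
    have hβ2pos : 0 < β2 := hβ1.trans_lt hβ12
    rw [Fintype.card_fin]
    gcongr
    refine le_div_self d.cast_nonneg (sub_pos.2 ((div_lt_one hβ2pos).2 hβ12)) ?_
    exact sub_le_self 1 (div_nonneg hβ1 hβ2pos.le)
  have hbound : 0 ≤ L * (C0 * √(d / (1 - β1 / β2))) := by positivity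
  intro s hs
  induction s, hs using Nat.le_induction with
  | base => push_cast; linarith
  | succ s hs ih =>
    have hdiff_le := (hsmooth (x (s + 1)) (x s)).trans
      (mul_le_mul_of_nonneg_left (hstep s hs) hL)
    have htri := norm_le_norm_add_norm_sub' (gradient f (x (s + 1))) (gradient f (x s))
    push_cast
    linarith
end

section
/- For the Adam iterates with 0 ≤ β1 < β2 < 1 and η = C0·√(1−β2) for a constant C0 > 0, if f is L-smooth then for every s ≥ 1: ‖∇f(x_s)‖ ≤ ‖∇f(y_s)‖ + M, where M := L·C0·√d / ((1−β1)·√(1−β1/β2)). -/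
/-- Joint step of the first and second moment estimates, as an invariant on their ratio. -/
theorem moment_ratio_step {β1 β2 m v g : ℝ} (hβ1 : 0 ≤ β1) (hβ12 : β1 < β2) (hβ2 : β2 < 1)
    (h : (1 - β2) * (1 - β1 / β2) * m ^ 2 ≤ (1 - β1) ^ 2 * v) :
    (1 - β2) * (1 - β1 / β2) * (β1 * m + (1 - β1) * g) ^ 2
      ≤ (1 - β1) ^ 2 * (β2 * v + (1 - β2) * g ^ 2) := by
  have hβ2pos : 0 < β2 := hβ1.trans_lt hβ12
  obtain ⟨r, hr⟩ : ∃ r, r = β1 / β2 := ⟨_, rfl⟩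
  have hr0 : 0 ≤ r := hr ▸ div_nonneg hβ1 hβ2pos.le
  have hr1 : r < 1 := hr ▸ (div_lt_one hβ2pos).2 hβ12
  have hβr : β1 = r * β2 := by rw [hr]; field_simp
  rw [← hr] at h ⊢
  have hcs : (1 - r) * (β1 * m + (1 - β1) * g) ^ 2
      ≤ β1 * β2 * (1 - r) * m ^ 2 + (1 - β1) ^ 2 * g ^ 2 := by
    have : 0 ≤ r * ((1 - r) * (β2 * m) - (1 - β1) * g) ^ 2 := by positivity
    have e : β1 * β2 * (1 - r) * m ^ 2 + (1 - β1) ^ 2 * g ^ 2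
        - (1 - r) * (β1 * m + (1 - β1) * g) ^ 2
        = r * ((1 - r) * (β2 * m) - (1 - β1) * g) ^ 2 := by
      rw [hβr]; ring
    linarith
  have hm : 0 ≤ (1 - β2) * (1 - r) * m ^ 2 :=
    mul_nonneg (mul_nonneg (by linarith) (by linarith)) (sq_nonneg m)
  have h1 := mul_le_mul_of_nonneg_left hcs (by linarith : 0 ≤ 1 - β2)
  have h2 := mul_le_mul_of_nonneg_left h hβ2pos.le
  have h3 : β1 * (β2 * ((1 - β2) * (1 - r) * m ^ 2)) ≤ 1 * (β2 * ((1 - β2) * (1 - r) * m ^ 2)) :=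
    mul_le_mul_of_nonneg_right (by linarith) (by positivity)
  linarith

/-- A coordinate of an Adam step is bounded by `C0 / √(1 - β1 / β2)` (squared form). -/
theorem adam_step_sq_le {β1 β2 C0 ε m v : ℝ} {k : ℕ} (hk : 1 ≤ k)
    (hβ1 : 0 ≤ β1) (hβ12 : β1 < β2) (hβ2 : β2 < 1) (hε : 0 < ε) (hv : 0 ≤ v)
    (h : (1 - β2) * (1 - β1 / β2) * m ^ 2 ≤ (1 - β1) ^ 2 * v) :
    (C0 * √(1 - β2) * √(1 - β2 ^ k) / (1 - β1 ^ k) * m / (√v + ε * √(1 - β2 ^ k))) ^ 2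
      ≤ C0 ^ 2 / (1 - β1 / β2) := by
  have hβ2pos : 0 < β2 := hβ1.trans_lt hβ12
  have hβ1lt : β1 < 1 := hβ12.trans hβ2
  have hr : 0 < 1 - β1 / β2 := sub_pos.2 ((div_lt_one hβ2pos).2 hβ12)
  have hp2 : 0 < 1 - β2 ^ k := sub_pos.2 (pow_lt_one₀ hβ2pos.le hβ2 (by omega))
  have hp2' : 1 - β2 ^ k ≤ 1 := by linarith [pow_pos hβ2pos k]
  have hp1 : 1 - β1 ≤ 1 - β1 ^ k := by
    linarith [pow_le_of_le_one hβ1 hβ1lt.le (by omega : k ≠ 0)]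
  have hq : 0 < 1 - β1 := by linarith
  have hp1pos : 0 < 1 - β1 ^ k := hq.trans_le hp1
  have hs : 0 < ε * √(1 - β2 ^ k) := mul_pos hε (Real.sqrt_pos.2 hp2)
  have hvb : v ≤ (√v + ε * √(1 - β2 ^ k)) ^ 2 :=
    calc v = √v ^ 2 := (Real.sq_sqrt hv).symm
      _ ≤ _ := pow_le_pow_left₀ (Real.sqrt_nonneg v) (by linarith) 2
  have hb : 0 < √v + ε * √(1 - β2 ^ k) := by positivity
  generalize √v + ε * √(1 - β2 ^ k) = b at hvb hb ⊢
  rw [div_pow, mul_pow, div_pow, mul_pow, mul_pow, Real.sq_sqrt (by linarith), Real.sq_sqrt hp2.le,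
    div_mul_eq_mul_div, div_div, div_le_div_iff₀ (by positivity) hr]
  calc C0 ^ 2 * (1 - β2) * (1 - β2 ^ k) * m ^ 2 * (1 - β1 / β2)
      = (1 - β2 ^ k) * (C0 ^ 2 * ((1 - β2) * (1 - β1 / β2) * m ^ 2)) := by ring
    _ ≤ 1 * (C0 ^ 2 * ((1 - β2) * (1 - β1 / β2) * m ^ 2)) :=
        mul_le_mul_of_nonneg_right hp2' (mul_nonneg (sq_nonneg _)
          (mul_nonneg (mul_nonneg (by linarith) hr.le) (sq_nonneg m)))
    _ = C0 ^ 2 * ((1 - β2) * (1 - β1 / β2) * m ^ 2) := one_mul _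
    _ ≤ C0 ^ 2 * ((1 - β1) ^ 2 * v) := by gcongr
    _ ≤ C0 ^ 2 * ((1 - β1 ^ k) ^ 2 * b ^ 2) := by gcongr

/-- A vector whose coordinates have square at most `a` has norm at most `√d * √a`. -/
theorem EuclideanSpace.norm_le_sqrt_mul_sqrt {d : ℕ} {a : ℝ} (z : EuclideanSpace ℝ (Fin d))
    (h : ∀ i, z i ^ 2 ≤ a) : ‖z‖ ≤ √d * √a := by
  rw [EuclideanSpace.norm_eq, ← Real.sqrt_mul (Nat.cast_nonneg d)]
  refine Real.sqrt_le_sqrt ?_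
  calc ∑ i, ‖z i‖ ^ 2 ≤ ∑ _i : Fin d, a :=
        Finset.sum_le_sum fun i _ => by simpa using h i
    _ = d * a := by simp


theorem stmt_9
    (d T : ℕ) (hd : 1 ≤ d) (hT : 1 ≤ T)
    (β1 β2 η ε : ℝ)
    (hβ1 : 0 ≤ β1) (hβ12 : β1 < β2) (hβ2 : β2 < 1)
    (hη : 0 < η) (hε : 0 < ε)
    (C0 : ℝ) (hC0 : 0 < C0) (hηC0 : η = C0 * Real.sqrt (1 - β2))
    (f : EuclideanSpace ℝ (Fin d) → ℝ) (L : ℝ)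
    (hdiff : Differentiable ℝ f)
    (hsmooth : ∀ y z : EuclideanSpace ℝ (Fin d),
      ‖gradient f y - gradient f z‖ ≤ L * ‖y - z‖)
    (g m v x y : ℕ → EuclideanSpace ℝ (Fin d))
    (hm0 : m 0 = 0) (hv0 : v 0 = 0)
    (hm : ∀ s, 1 ≤ s → ∀ i, m s i = β1 * m (s - 1) i + (1 - β1) * g s i)
    (hv : ∀ s, 1 ≤ s → ∀ i, v s i = β2 * v (s - 1) i + (1 - β2) * (g s i) ^ 2)
    (ηs : ℕ → ℝ) (hηs : ∀ s, 1 ≤ s → ηs s = η * Real.sqrt (1 - β2 ^ s) / (1 - β1 ^ s))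
    (b : ℕ → Fin d → ℝ)
    (hb : ∀ s i, b s i = Real.sqrt (v s i) + ε * Real.sqrt (1 - β2 ^ s))
    (hx : ∀ s, 1 ≤ s → ∀ i, x (s + 1) i = x s i - ηs s * m s i / b s i)
    (hy1 : y 1 = x 1)
    (hy : ∀ s, 2 ≤ s → y s = x s + (β1 / (1 - β1)) • (x s - x (s - 1))) :
    ∀ s : ℕ, 1 ≤ s →
      ‖gradient f (x s)‖ ≤
        ‖gradient f (y s)‖ +
          L * C0 * Real.sqrt d / ((1 - β1) * Real.sqrt (1 - β1 / β2)) := by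
  have hβ2pos : 0 < β2 := hβ1.trans_lt hβ12
  have hq : 0 < 1 - β1 := by linarith
  have hr : 0 < 1 - β1 / β2 := sub_pos.2 ((div_lt_one hβ2pos).2 hβ12)
  have hL : 0 ≤ L := by
    have h := (norm_nonneg _).trans (hsmooth (EuclideanSpace.single ⟨0, hd⟩ 1) 0)
    simpa using h
  have hinv : ∀ k i, 0 ≤ v k i ∧
      (1 - β2) * (1 - β1 / β2) * m k i ^ 2 ≤ (1 - β1) ^ 2 * v k i := by
    intro k i
    induction k with
    | zero => simp [hm0, hv0]
    | succ k ih =>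
      rw [hm (k + 1) (by omega), hv (k + 1) (by omega), Nat.add_sub_cancel]
      exact ⟨add_nonneg (mul_nonneg hβ2pos.le ih.1) (mul_nonneg (by linarith) (sq_nonneg _)),
        moment_ratio_step hβ1 hβ12 hβ2 ih.2⟩
  have hstep : ∀ k, 1 ≤ k → ‖x (k + 1) - x k‖ ≤ √d * (C0 / √(1 - β1 / β2)) := by
    intro k hk
    have h : C0 / √(1 - β1 / β2) = √(C0 ^ 2 / (1 - β1 / β2)) := by
      rw [Real.sqrt_div (sq_nonneg C0), Real.sqrt_sq hC0.le]
    rw [h]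
    refine EuclideanSpace.norm_le_sqrt_mul_sqrt _ fun i => ?_
    rw [PiLp.sub_apply, hx k hk, hb, hηs k hk, hηC0, sub_sub_cancel_left, neg_sq]
    exact adam_step_sq_le hk hβ1 hβ12 hβ2 hε (hinv k i).1 (hinv k i).2
  have hxy : ∀ s, 1 ≤ s → ‖x s - y s‖ ≤ √d * (C0 / √(1 - β1 / β2)) / (1 - β1) := by
    intro s hs
    obtain rfl | hs2 := hs.eq_or_lt
    · rw [hy1, sub_self, norm_zero]
      positivity
    · obtain ⟨k, rfl⟩ : ∃ k, s = k + 1 := ⟨s - 1, by omega⟩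
      rw [hy _ hs2, sub_add_cancel_left, norm_neg, norm_smul, Nat.add_sub_cancel,
        Real.norm_of_nonneg (by positivity), div_mul_eq_mul_div]
      refine div_le_div_of_nonneg_right ?_ hq.le
      calc β1 * ‖x (k + 1) - x k‖ ≤ 1 * ‖x (k + 1) - x k‖ := by gcongr; linarith
        _ ≤ _ := by rw [one_mul]; exact hstep k (by omega)
  intro s hs
  calc ‖gradient f (x s)‖ ≤ ‖gradient f (y s)‖ + ‖gradient f (x s) - gradient f (y s)‖ :=
        norm_le_insert' _ _
    _ ≤ ‖gradient f (y s)‖ + L * (√d * (C0 / √(1 - β1 / β2)) / (1 - β1)) := by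
        gcongr
        exact (hsmooth _ _).trans (mul_le_mul_of_nonneg_left (hxy s hs) hL)
    _ = _ := by
        congr 1
        field_simp
end

section
/- Assume the noise bound event: for all s ∈ [T], ‖ξ_s‖² ≤ M_T²·(σ0² + σ1²‖ḡ_s‖^p). Define a_s = √(β2 v_{s−1} + (1−β2)·𝒢_T(s)²·1_d) + ε_s·1_d (coordinate-wise), with coordinates a_{s,i}. Then for all s ∈ [T] and i ∈ [d]: | 1/a_{s,i} − 1/b_{s,i} | ≤ 𝒢_T(s)·√(1−β2) / (a_{s,i}·b_{s,i}), and for all 2 ≤ s ≤ T: | 1/a_{s,i} − 1/b_{s−1,i} | ≤ (𝒢_T(s) + ε)·√(1−β2) / (a_{s,i}·b_{s−1,i}). -/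
lemma le_biSup_Icc_of_nonneg {u : ℕ → ℝ} (hu : ∀ j, 0 ≤ u j) {j s : ℕ}
    (hj : j ∈ Finset.Icc 1 s) : u j ≤ ⨆ k ∈ Finset.Icc 1 s, u k := by
  have hle : ∀ k, ⨆ _ : k ∈ Finset.Icc 1 s, u k ≤ ∑ l ∈ Finset.Icc 1 s, u l := fun k =>
    Real.iSup_le (fun hk => Finset.single_le_sum (fun l _ => hu l) hk)
      (Finset.sum_nonneg fun l _ => hu l)
  have hbdd : BddAbove (Set.range fun k => ⨆ _ : k ∈ Finset.Icc 1 s, u k) :=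
    ⟨_, Set.forall_mem_range.2 hle⟩
  simpa [hj] using le_ciSup hbdd j

lemma abs_sqrt_sub_sqrt_le {A B c t : ℝ} (hB : 0 ≤ B) (hBA : B ≤ A) (hc : 0 ≤ c)
    (ht : 0 ≤ t) (h : A - B ≤ c ^ 2 * t) : |√A - √B| ≤ c * √t := by
  rw [abs_of_nonneg (sub_nonneg.2 (Real.sqrt_le_sqrt hBA)), sub_le_iff_le_add]
  refine Real.sqrt_le_iff.2 ⟨by positivity, ?_⟩
  have hcross : 0 ≤ c * √t * √B := by positivity
  nlinarith [Real.sq_sqrt hB, Real.sq_sqrt ht]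

lemma abs_one_div_sub_one_div_le {a b C : ℝ} (ha : 0 < a) (hb : 0 < b) (h : |a - b| ≤ C) :
    |1 / a - 1 / b| ≤ C / (a * b) := by
  rw [div_sub_div _ _ ha.ne' hb.ne', abs_div, abs_of_pos (mul_pos ha hb), one_mul, mul_one,
    abs_sub_comm]
  gcongr

lemma exp_moving_average_mem_Icc {β C : ℝ} (hβ : 0 ≤ β) (hβ' : β ≤ 1) (hC : 0 ≤ C)
    {v w : ℕ → ℝ} {s : ℕ} (hv0 : v 0 = 0)
    (hv : ∀ j, 1 ≤ j → v j = β * v (j - 1) + (1 - β) * w j)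
    (hw : ∀ j, 1 ≤ j → j ≤ s → w j ∈ Set.Icc 0 C) :
    ∀ j ≤ s, v j ∈ Set.Icc 0 C := by
  intro j
  induction j with
  | zero => intro _; simp [hv0, hC]
  | succ n ih =>
    intro hn
    have h := hv (n + 1) (by omega)
    rw [Nat.add_sub_cancel] at h
    rw [h]
    exact convex_Icc 0 C (ih (by omega)) (hw (n + 1) (by omega) hn) hβ (sub_nonneg.2 hβ')
      (add_sub_cancel _ _)

lemma norm_add_sq_le_two_mul {E : Type*} [SeminormedAddCommGroup E] (x y : E) :
    ‖x + y‖ ^ 2 ≤ 2 * ‖x‖ ^ 2 + 2 * ‖y‖ ^ 2 := by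
  have := norm_add_le x y
  nlinarith [norm_nonneg (x + y), sq_nonneg (‖x‖ - ‖y‖)]

lemma one_le_sqrt_log_exp_one_mul_div {T : ℕ} (hT : 1 ≤ T) {δ : ℝ} (hδ0 : 0 < δ)
    (hδ1 : δ < 1) : 1 ≤ √(Real.log (Real.exp 1 * T / δ)) := by
  have hT' : (1 : ℝ) ≤ T := by exact_mod_cast hT
  rw [Real.one_le_sqrt, Real.le_log_iff_exp_le (by positivity), le_div_iff₀ hδ0]
  gcongr
  linarith

theorem stmt_13
    (d T : ℕ) (hd : 1 ≤ d) (hT : 1 ≤ T)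
    (β1 β2 η ε : ℝ)
    (hβ1 : 0 ≤ β1) (hβ1' : β1 < 1) (hβ2 : 0 < β2) (hβ2' : β2 < 1)
    (hη : 0 < η) (hε : 0 < ε)
    (f : EuclideanSpace ℝ (Fin d) → ℝ) (hdiff : Differentiable ℝ f)
    (g m v x : ℕ → EuclideanSpace ℝ (Fin d))
    (hm0 : m 0 = 0) (hv0 : v 0 = 0)
    (hm : ∀ s, 1 ≤ s → ∀ i, m s i = β1 * m (s - 1) i + (1 - β1) * g s i)
    (hv : ∀ s, 1 ≤ s → ∀ i, v s i = β2 * v (s - 1) i + (1 - β2) * (g s i) ^ 2)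
    (ηs : ℕ → ℝ) (hηs : ∀ s, 1 ≤ s → ηs s = η * Real.sqrt (1 - β2 ^ s) / (1 - β1 ^ s))
    (b : ℕ → Fin d → ℝ)
    (hb : ∀ s i, b s i = Real.sqrt (v s i) + ε * Real.sqrt (1 - β2 ^ s))
    (hx : ∀ s, 1 ≤ s → ∀ i, x (s + 1) i = x s i - ηs s * m s i / b s i)
    (ξ : ℕ → EuclideanSpace ℝ (Fin d))
    (hξ : ∀ s, ξ s = g s - gradient f (x s))
    (σ0 σ1 p : ℝ) (hσ0 : 0 < σ0) (hσ1 : 0 < σ1) (hp0 : 0 ≤ p) (hp4 : p < 4)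
    (δ : ℝ) (hδ0 : 0 < δ) (hδ1 : δ < 1)
    (MT : ℝ) (hMT : MT = Real.sqrt (Real.log (Real.exp 1 * T / δ)))
    (G : ℕ → ℝ) (hG : ∀ s, G s = ⨆ j ∈ Finset.Icc 1 s, ‖gradient f (x j)‖)
    (𝒢 : ℕ → ℝ)
    (h𝒢 : ∀ s, 𝒢 s = MT * Real.sqrt (2 * σ0 ^ 2 + 2 * σ1 ^ 2 * (G s) ^ p + 2 * (G s) ^ 2))
    (hnoise : ∀ s ∈ Finset.Icc 1 T,
      ‖ξ s‖ ^ 2 ≤ MT ^ 2 * (σ0 ^ 2 + σ1 ^ 2 * ‖gradient f (x s)‖ ^ p))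
    (a : ℕ → Fin d → ℝ)
    (ha : ∀ s i, a s i =
      Real.sqrt (β2 * v (s - 1) i + (1 - β2) * (𝒢 s) ^ 2) + ε * Real.sqrt (1 - β2 ^ s)) :
    (∀ s ∈ Finset.Icc 1 T, ∀ i : Fin d,
      |1 / a s i - 1 / b s i| ≤ 𝒢 s * Real.sqrt (1 - β2) / (a s i * b s i)) ∧
    (∀ s, 2 ≤ s → s ≤ T → ∀ i : Fin d,
      |1 / a s i - 1 / b (s - 1) i| ≤
        (𝒢 s + ε) * Real.sqrt (1 - β2) / (a s i * b (s - 1) i)) := by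
  have hMT1 : 1 ≤ MT := hMT ▸ one_le_sqrt_log_exp_one_mul_div hT hδ0 hδ1
  have h𝒢0 : ∀ s, 0 ≤ 𝒢 s := fun s => by rw [h𝒢]; positivity
  have hgrad : ∀ j s, 1 ≤ j → j ≤ s → ‖gradient f (x j)‖ ≤ G s := fun j s h1 h2 => by
    rw [hG]
    exact le_biSup_Icc_of_nonneg (u := fun k => ‖gradient f (x k)‖)
      (fun _ => norm_nonneg _) (Finset.mem_Icc.2 ⟨h1, h2⟩)
  have hg : ∀ s ≤ T, ∀ i j, 1 ≤ j → j ≤ s → (g j i) ^ 2 ∈ Set.Icc 0 ((𝒢 s) ^ 2) := by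
    intro s hs i j h1 h2
    refine ⟨sq_nonneg _, ?_⟩
    have hle := hgrad j s h1 h2
    have hG0 : 0 ≤ G s := (norm_nonneg _).trans hle
    have hcoord : (g j i) ^ 2 ≤ ‖g j‖ ^ 2 := by
      rw [← sq_abs, ← Real.norm_eq_abs]
      gcongr
      exact PiLp.norm_apply_le (g j) i
    have hsplit := norm_add_sq_le_two_mul (ξ j) (gradient f (x j))
    rw [hξ, sub_add_cancel, ← hξ] at hsplit
    have hpow : ‖gradient f (x j)‖ ^ p ≤ G s ^ p := by gcongr
    have hsq : ‖gradient f (x j)‖ ^ 2 ≤ G s ^ 2 := by gcongr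
    have hMsq : 1 ≤ MT ^ 2 := one_le_pow₀ hMT1
    rw [h𝒢, mul_pow, Real.sq_sqrt (by positivity)]
    calc (g j i) ^ 2 ≤ 2 * ‖ξ j‖ ^ 2 + 2 * ‖gradient f (x j)‖ ^ 2 := hcoord.trans hsplit
      _ ≤ 2 * (MT ^ 2 * (σ0 ^ 2 + σ1 ^ 2 * ‖gradient f (x j)‖ ^ p))
            + 2 * ‖gradient f (x j)‖ ^ 2 := by
          gcongr
          exact hnoise j (Finset.mem_Icc.2 ⟨h1, h2.trans hs⟩)
      _ ≤ 2 * (MT ^ 2 * (σ0 ^ 2 + σ1 ^ 2 * G s ^ p)) + 2 * (MT ^ 2 * G s ^ 2) := by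
          gcongr
          exact hsq.trans (le_mul_of_one_le_left (sq_nonneg _) hMsq)
      _ = MT ^ 2 * (2 * σ0 ^ 2 + 2 * σ1 ^ 2 * G s ^ p + 2 * G s ^ 2) := by ring
  have hvmem : ∀ s ≤ T, ∀ i, ∀ j ≤ s, v j i ∈ Set.Icc 0 ((𝒢 s) ^ 2) := fun s hs i =>
    exp_moving_average_mem_Icc (v := fun j => v j i) (w := fun j => (g j i) ^ 2) hβ2.le
      hβ2'.le (sq_nonneg _) (by simp [hv0]) (fun j hj => hv j hj i) (hg s hs i)
  have hε_pos : ∀ s, 1 ≤ s → 0 < ε * √(1 - β2 ^ s) := fun s hs =>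
    mul_pos hε (Real.sqrt_pos.2 (sub_pos.2 (pow_lt_one₀ hβ2.le hβ2' (by omega))))
  have ha_pos : ∀ s i, 1 ≤ s → 0 < a s i := fun s i hs => by
    rw [ha]; exact add_pos_of_nonneg_of_pos (Real.sqrt_nonneg _) (hε_pos s hs)
  have hb_pos : ∀ s i, 1 ≤ s → 0 < b s i := fun s i hs => by
    rw [hb]; exact add_pos_of_nonneg_of_pos (Real.sqrt_nonneg _) (hε_pos s hs)
  have hβ0 : 0 ≤ 1 - β2 := sub_nonneg.2 hβ2'.le
  refine ⟨fun s hs i => ?_, fun s hs hsT i => ?_⟩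
  · obtain ⟨h1, h2⟩ := Finset.mem_Icc.1 hs
    refine abs_one_div_sub_one_div_le (ha_pos s i h1) (hb_pos s i h1) ?_
    obtain ⟨hv_nonneg, -⟩ := hvmem s h2 i (s - 1) (by omega)
    obtain ⟨hg_nonneg, hg_le⟩ := hg s h2 i s h1 le_rfl
    rw [ha, hb, add_sub_add_right_eq_sub, hv s h1]
    refine abs_sqrt_sub_sqrt_le (by positivity) (by gcongr) (h𝒢0 s) hβ0 ?_
    nlinarith [mul_nonneg hβ0 hg_nonneg]
  · refine abs_one_div_sub_one_div_le (ha_pos s i (by omega)) (hb_pos (s - 1) i (by omega)) ?_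
    obtain ⟨hv_nonneg, hv_le⟩ := hvmem s hsT i (s - 1) (by omega)
    have hsqrt : |√(β2 * v (s - 1) i + (1 - β2) * 𝒢 s ^ 2) - √(v (s - 1) i)|
        ≤ 𝒢 s * √(1 - β2) := by
      refine abs_sqrt_sub_sqrt_le hv_nonneg ?_ (h𝒢0 s) hβ0 ?_
      · nlinarith [mul_nonneg hβ0 (sub_nonneg.2 hv_le)]
      · nlinarith [mul_nonneg hβ0 hv_nonneg]
    have hcorr : |√(1 - β2 ^ s) - √(1 - β2 ^ (s - 1))| ≤ 1 * √(1 - β2) := by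
      have hpow : β2 ^ s = β2 ^ (s - 1) * β2 := by rw [← pow_succ]; congr 1; omega
      have hpow_le : β2 ^ (s - 1) ≤ 1 := pow_le_one₀ hβ2.le hβ2'.le
      have hpow_nonneg : 0 ≤ β2 ^ (s - 1) := by positivity
      refine abs_sqrt_sub_sqrt_le (by linarith) ?_ zero_le_one hβ0 ?_ <;> rw [hpow] <;> nlinarith
    rw [ha, hb, add_sub_add_comm, ← mul_sub, add_mul]
    refine (abs_add_le _ _).trans (add_le_add hsqrt ?_)
    rw [abs_mul, abs_of_pos hε]
    rw [one_mul] at hcorr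
    gcongr
end

section
/- Assume f is L-smooth, 0 ≤ β1 < β2 < 1, η = C0·√(1−β2), and the noise bound event: for all s ∈ [T], ‖ξ_s‖² ≤ M_T²·(σ0² + σ1²‖ḡ_s‖^p). Then for all t ∈ [T] and i ∈ [d]: F_i(t) ≤ F(T) := 1 + (2M_T²/ε²)·[ σ0²·T + σ1²·T·(‖ḡ_1‖ + T·M̂)^p + T·(‖ḡ_1‖ + T·M̂)² ], where M̂ = L·C0·√(d/(1−β1/β2)) and F_i(t) = 1 + (1/ε²)·Σ_{s=1}^t g_{s,i}². -/
theorem sq_momentum_le_second_moment {β1 β2 : ℝ} (hβ1 : 0 ≤ β1) (hβ12 : β1 ≤ β2) (hβ2 : β2 ≤ 1)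
    {m v g : ℕ → ℝ} (hm0 : m 0 = 0) (hv0 : v 0 = 0)
    (hm : ∀ s, 1 ≤ s → m s = β1 * m (s - 1) + (1 - β1) * g s)
    (hv : ∀ s, 1 ≤ s → v s = β2 * v (s - 1) + (1 - β2) * g s ^ 2) (s : ℕ) :
    0 ≤ v s ∧ (1 - β2) * m s ^ 2 ≤ (1 - β1) * v s := by
  induction s with
  | zero => simp [hm0, hv0]
  | succ s ih =>
    obtain ⟨hvs, hms⟩ := ih
    rw [hm (s + 1) s.succ_pos, hv (s + 1) s.succ_pos, Nat.add_sub_cancel]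
    have h2 : 0 ≤ 1 - β2 := by linarith
    have h1 : 0 ≤ 1 - β1 := by linarith
    refine ⟨add_nonneg (mul_nonneg (hβ1.trans hβ12) hvs) (mul_nonneg h2 (sq_nonneg _)), ?_⟩
    have hconv : (β1 * m s + (1 - β1) * g (s + 1)) ^ 2
        ≤ β1 * m s ^ 2 + (1 - β1) * g (s + 1) ^ 2 := by
      nlinarith [mul_nonneg (mul_nonneg hβ1 h1) (sq_nonneg (m s - g (s + 1)))]
    have hβ : β1 * ((1 - β1) * v s) ≤ β2 * ((1 - β1) * v s) :=
      mul_le_mul_of_nonneg_right hβ12 (mul_nonneg h1 hvs)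
    have hm' := mul_le_mul_of_nonneg_left hms hβ1
    have hc' := mul_le_mul_of_nonneg_left hconv h2
    linarith

theorem abs_adam_step_le {β1 β2 C ε m v : ℝ} {s : ℕ} (hs : s ≠ 0)
    (hβ1 : 0 ≤ β1) (hβ12 : β1 < β2) (hβ2 : β2 < 1) (hC : 0 ≤ C) (hε : 0 < ε)
    (h : (1 - β2) * m ^ 2 ≤ (1 - β1) * v) :
    |C * √(1 - β2) * √(1 - β2 ^ s) / (1 - β1 ^ s) * m / (√v + ε * √(1 - β2 ^ s))|
      ≤ C * √(1 / (1 - β1 / β2)) := by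
  have hβ2' : 0 < β2 := hβ1.trans_lt hβ12
  have h1 : 0 < 1 - β1 := by linarith
  have h2 : 0 < 1 - β2 := by linarith
  have hp1 : 1 - β1 ≤ 1 - β1 ^ s := by
    linarith [pow_le_of_le_one hβ1 (by linarith : β1 ≤ 1) hs]
  have hp2 : 0 < 1 - β2 ^ s := by linarith [pow_lt_one₀ hβ2'.le hβ2 hs]
  have hb : 0 < √v + ε * √(1 - β2 ^ s) := by positivity
  have hm : √(1 - β2) * |m| ≤ √(1 - β1) * √v := by
    rw [← Real.sqrt_sq_eq_abs, ← Real.sqrt_mul h2.le, ← Real.sqrt_mul h1.le]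
    exact Real.sqrt_le_sqrt h
  have hle : √(1 - β2 ^ s) ≤ 1 :=
    Real.sqrt_le_one.mpr (by linarith [pow_nonneg hβ2'.le s])
  have hratio : β1 ≤ β1 / β2 := le_div_self hβ1 hβ2' hβ2.le
  have hratio' : 0 < 1 - β1 / β2 := by linarith [(div_lt_one hβ2').mpr hβ12]
  calc _ = C * √(1 - β2 ^ s) * (√(1 - β2) * |m| / (√v + ε * √(1 - β2 ^ s))) / (1 - β1 ^ s) := by
        rw [abs_div, abs_mul, abs_div, abs_of_pos hb, abs_of_pos (h1.trans_le hp1),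
          abs_of_nonneg (by positivity : 0 ≤ C * √(1 - β2) * √(1 - β2 ^ s))]
        ring
    _ ≤ C * 1 * √(1 - β1) / (1 - β1) := by
        have : √(1 - β2) * |m| / (√v + ε * √(1 - β2 ^ s)) ≤ √(1 - β1) := by
          rw [div_le_iff₀ hb]
          refine hm.trans (mul_le_mul_of_nonneg_left ?_ (Real.sqrt_nonneg _))
          linarith [mul_nonneg hε.le (Real.sqrt_nonneg (1 - β2 ^ s))]
        gcongr
    _ = C * √(1 / (1 - β1)) := by
        rw [mul_one, mul_div_assoc, Real.sqrt_div_self, Real.sqrt_div zero_le_one, Real.sqrt_one,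
          one_div]
    _ ≤ C * √(1 / (1 - β1 / β2)) := by gcongr

theorem EuclideanSpace.norm_le_sqrt_mul {d : ℕ} {y : EuclideanSpace ℝ (Fin d)} {c : ℝ}
    (hc : 0 ≤ c) (h : ∀ i, |y i| ≤ c) : ‖y‖ ≤ √d * c := by
  rw [EuclideanSpace.norm_eq]
  calc √(∑ i, ‖y i‖ ^ 2) ≤ √(d * c ^ 2) := by
        refine Real.sqrt_le_sqrt ?_
        calc ∑ i, ‖y i‖ ^ 2 ≤ ∑ _i : Fin d, c ^ 2 :=
              Finset.sum_le_sum fun i _ => pow_le_pow_left₀ (norm_nonneg _) (h i) 2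
          _ = d * c ^ 2 := by simp
    _ = √d * c := by rw [Real.sqrt_mul d.cast_nonneg, Real.sqrt_sq hc]

theorem norm_le_add_mul_of_step_le {E : Type*} [SeminormedAddCommGroup E] {u : ℕ → E} {K : ℝ}
    (h : ∀ s, 1 ≤ s → ‖u (s + 1) - u s‖ ≤ K) {s : ℕ} (hs : 1 ≤ s) :
    ‖u s‖ ≤ ‖u 1‖ + s * K := by
  induction s, hs using Nat.le_induction with
  | base => simpa using (norm_nonneg _).trans (h 1 le_rfl)
  | succ s hs ih =>
    have := norm_le_norm_add_norm_sub' (u (s + 1)) (u s)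
    push_cast
    linarith [h s hs]


theorem stmt_14
    (d T : ℕ) (hd : 1 ≤ d) (hT : 1 ≤ T)
    (β1 β2 η ε : ℝ)
    (hβ1 : 0 ≤ β1) (hβ12 : β1 < β2) (hβ2 : β2 < 1)
    (hη : 0 < η) (hε : 0 < ε)
    (C0 : ℝ) (hC0 : 0 < C0) (hηC0 : η = C0 * Real.sqrt (1 - β2))
    (f : EuclideanSpace ℝ (Fin d) → ℝ) (L : ℝ)
    (hdiff : Differentiable ℝ f)
    (hsmooth : ∀ y z : EuclideanSpace ℝ (Fin d),
      ‖gradient f y - gradient f z‖ ≤ L * ‖y - z‖)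
    (g m v x : ℕ → EuclideanSpace ℝ (Fin d))
    (hm0 : m 0 = 0) (hv0 : v 0 = 0)
    (hm : ∀ s, 1 ≤ s → ∀ i, m s i = β1 * m (s - 1) i + (1 - β1) * g s i)
    (hv : ∀ s, 1 ≤ s → ∀ i, v s i = β2 * v (s - 1) i + (1 - β2) * (g s i) ^ 2)
    (ηs : ℕ → ℝ) (hηs : ∀ s, 1 ≤ s → ηs s = η * Real.sqrt (1 - β2 ^ s) / (1 - β1 ^ s))
    (b : ℕ → Fin d → ℝ)
    (hb : ∀ s i, b s i = Real.sqrt (v s i) + ε * Real.sqrt (1 - β2 ^ s))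
    (hx : ∀ s, 1 ≤ s → ∀ i, x (s + 1) i = x s i - ηs s * m s i / b s i)
    (ξ : ℕ → EuclideanSpace ℝ (Fin d))
    (hξ : ∀ s, ξ s = g s - gradient f (x s))
    (σ0 σ1 p : ℝ) (hσ0 : 0 < σ0) (hσ1 : 0 < σ1) (hp0 : 0 ≤ p) (hp4 : p < 4)
    (δ : ℝ) (hδ0 : 0 < δ) (hδ1 : δ < 1)
    (MT : ℝ) (hMT : MT = Real.sqrt (Real.log (Real.exp 1 * T / δ)))
    (hnoise : ∀ s ∈ Finset.Icc 1 T,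
      ‖ξ s‖ ^ 2 ≤ MT ^ 2 * (σ0 ^ 2 + σ1 ^ 2 * ‖gradient f (x s)‖ ^ p))
    (Mhat : ℝ) (hMhat : Mhat = L * C0 * Real.sqrt (d / (1 - β1 / β2))) :
    ∀ t ∈ Finset.Icc 1 T, ∀ i : Fin d,
      1 + (1 / ε ^ 2) * ∑ s ∈ Finset.Icc 1 t, (g s i) ^ 2 ≤
        1 + (2 * MT ^ 2 / ε ^ 2) *
          (σ0 ^ 2 * T + σ1 ^ 2 * T * (‖gradient f (x 1)‖ + T * Mhat) ^ p +
            T * (‖gradient f (x 1)‖ + T * Mhat) ^ 2) := by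
  intro t ht i
  have hβ2' : 0 < β2 := hβ1.trans_lt hβ12
  have hρ : 0 < 1 - β1 / β2 := by linarith [(div_lt_one hβ2').mpr hβ12]
  have hL : 0 ≤ L := by
    have hne : EuclideanSpace.single i (1 : ℝ) - 0 ≠ 0 := by simp
    exact nonneg_of_mul_nonneg_left ((norm_nonneg _).trans (hsmooth _ _)) (norm_pos_iff.mpr hne)
  have hstep : ∀ s, 1 ≤ s → ‖gradient f (x (s + 1)) - gradient f (x s)‖ ≤ Mhat := by
    intro s hs
    refine (hsmooth _ _).trans ?_
    have hnorm : ‖x (s + 1) - x s‖ ≤ √d * (C0 * √(1 / (1 - β1 / β2))) := by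
      refine EuclideanSpace.norm_le_sqrt_mul (by positivity) fun j => ?_
      have hmv := (sq_momentum_le_second_moment hβ1 hβ12.le hβ2.le (m := fun s => m s j)
        (v := fun s => v s j) (g := fun s => g s j) (by simp [hm0]) (by simp [hv0])
        (fun s hs => hm s hs j) (fun s hs => hv s hs j) s).2
      have := abs_adam_step_le (Nat.one_le_iff_ne_zero.mp hs) hβ1 hβ12 hβ2 hC0.le hε hmv
      rw [PiLp.sub_apply, hx s hs j, sub_sub_cancel_left, abs_neg, hηs s hs, hb, hηC0]
      exact this
    calc L * ‖x (s + 1) - x s‖ ≤ L * (√d * (C0 * √(1 / (1 - β1 / β2)))) := by gcongr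
      _ = Mhat := by
        rw [hMhat, div_eq_mul_one_div (d : ℝ), Real.sqrt_mul d.cast_nonneg]
        ring
  have hM : 0 ≤ Mhat := (norm_nonneg _).trans (hstep 1 le_rfl)
  set G : ℝ := ‖gradient f (x 1)‖ + T * Mhat with hG
  have hMT1 : 1 ≤ MT ^ 2 := by
    have hT' : (1 : ℝ) ≤ T := by exact_mod_cast hT
    have h1 : 1 ≤ Real.log (Real.exp 1 * T / δ) := by
      rw [Real.le_log_iff_exp_le (by positivity), le_div_iff₀ hδ0]
      exact mul_le_mul_of_nonneg_left (hδ1.le.trans hT') (Real.exp_pos 1).le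
    rwa [hMT, Real.sq_sqrt (zero_le_one.trans h1)]
  have hg : ∀ s ∈ Finset.Icc 1 T,
      g s i ^ 2 ≤ 2 * MT ^ 2 * (σ0 ^ 2 + σ1 ^ 2 * G ^ p + G ^ 2) := by
    intro s hs
    have hs' := Finset.mem_Icc.mp hs
    have hgrad : ‖gradient f (x s)‖ ≤ G := by
      refine (norm_le_add_mul_of_step_le (u := fun s => gradient f (x s)) hstep hs'.1).trans ?_
      have : (s : ℝ) ≤ T := by exact_mod_cast hs'.2
      rw [hG]
      gcongr
    have hpow : ‖gradient f (x s)‖ ^ p ≤ G ^ p := Real.rpow_le_rpow (norm_nonneg _) hgrad hp0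
    have hsq : ‖gradient f (x s)‖ ^ 2 ≤ G ^ 2 := pow_le_pow_left₀ (norm_nonneg _) hgrad 2
    have hcoord : g s i ^ 2 ≤ ‖g s‖ ^ 2 := by
      rw [← sq_abs, ← Real.norm_eq_abs]
      exact pow_le_pow_left₀ (norm_nonneg _) (PiLp.norm_apply_le (g s) i) 2
    have htri : ‖g s‖ ≤ ‖ξ s‖ + ‖gradient f (x s)‖ := by
      have : g s = ξ s + gradient f (x s) := by rw [hξ, sub_add_cancel]
      rw [this]
      exact norm_add_le _ _
    calc g s i ^ 2 ≤ (‖ξ s‖ + ‖gradient f (x s)‖) ^ 2 :=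
          hcoord.trans (pow_le_pow_left₀ (norm_nonneg _) htri 2)
      _ ≤ 2 * (‖ξ s‖ ^ 2 + ‖gradient f (x s)‖ ^ 2) := add_sq_le
      _ ≤ 2 * (MT ^ 2 * (σ0 ^ 2 + σ1 ^ 2 * G ^ p) + MT ^ 2 * G ^ 2) := by
          have h1 := hnoise s hs
          have h2 : G ^ 2 ≤ MT ^ 2 * G ^ 2 := le_mul_of_one_le_left (sq_nonneg _) hMT1
          have h3 : MT ^ 2 * (σ0 ^ 2 + σ1 ^ 2 * ‖gradient f (x s)‖ ^ p)
              ≤ MT ^ 2 * (σ0 ^ 2 + σ1 ^ 2 * G ^ p) := by gcongr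
          linarith
      _ = _ := by ring
  have hsum : ∑ s ∈ Finset.Icc 1 t, g s i ^ 2
      ≤ T * (2 * MT ^ 2 * (σ0 ^ 2 + σ1 ^ 2 * G ^ p + G ^ 2)) :=
    calc ∑ s ∈ Finset.Icc 1 t, g s i ^ 2 ≤ ∑ s ∈ Finset.Icc 1 T, g s i ^ 2 :=
          Finset.sum_le_sum_of_subset_of_nonneg
            (Finset.Icc_subset_Icc_right (Finset.mem_Icc.mp ht).2) fun _ _ _ => sq_nonneg _
      _ ≤ ∑ _s ∈ Finset.Icc 1 T, 2 * MT ^ 2 * (σ0 ^ 2 + σ1 ^ 2 * G ^ p + G ^ 2) :=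
          Finset.sum_le_sum hg
      _ = _ := by simp
  calc 1 + 1 / ε ^ 2 * ∑ s ∈ Finset.Icc 1 t, g s i ^ 2
      ≤ 1 + 1 / ε ^ 2 * (T * (2 * MT ^ 2 * (σ0 ^ 2 + σ1 ^ 2 * G ^ p + G ^ 2))) := by gcongr
    _ = _ := by ring
end

section
/- Suppose f is (L0,Lq)-smooth and bounded below by f*. Then for every x ∈ ℝ^d: ‖∇f(x)‖ ≤ max{ 4Lq(f(x) − f*), (4Lq(f(x) − f*))^{1/(2−q)}, √(4L0(f(x) − f*)) }. -/
/-- Descent along the normalized negative gradient: if `∇f` is `M`-Lipschitz at `x` along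
displacements of length at most `r`, then a step of length `t ≤ r` decreases `f` by at least
`t * ‖∇f x‖ - M * t ^ 2 / 2`. -/
theorem descent_along_normalized_gradient {E : Type*} [NormedAddCommGroup E]
    [InnerProductSpace ℝ E] [CompleteSpace E] {f : E → ℝ} (hf : Differentiable ℝ f) {x : E}
    {M r t : ℝ} (hx : gradient f x ≠ 0) (ht : 0 ≤ t) (htr : t ≤ r)
    (hM : ∀ y, ‖x - y‖ ≤ r → ‖gradient f y - gradient f x‖ ≤ M * ‖x - y‖) :
    f (x - (t / ‖gradient f x‖) • gradient f x) ≤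
      f x - (t * ‖gradient f x‖ - M * t ^ 2 / 2) := by
  have hg : 0 < ‖gradient f x‖ := norm_pos_iff.mpr hx
  set v := ‖gradient f x‖⁻¹ • gradient f x with hv
  have hv1 : ‖v‖ = 1 := by
    rw [hv, norm_smul, norm_inv, norm_norm, inv_mul_cancel₀ hg.ne']
  have hgv : inner ℝ (gradient f x) v = ‖gradient f x‖ := by
    rw [hv, inner_smul_right, real_inner_self_eq_norm_sq]
    field_simp
  have hderiv (s : ℝ) : HasDerivAt (fun s ↦ f (x - s • v) + s * ‖gradient f x‖ - M * s ^ 2 / 2)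
      (-inner ℝ (gradient f (x - s • v)) v + ‖gradient f x‖ - M * s) s := by
    have hline : HasDerivAt (fun s : ℝ ↦ x - s • v) (-v) s := by
      simpa using ((hasDerivAt_id s).smul_const v).const_sub x
    have hcomp := (hf (x - s • v)).hasGradientAt.hasFDerivAt.comp_hasDerivAt s hline
    have hsq : HasDerivAt (fun s : ℝ ↦ M * s ^ 2 / 2) (M * s) s := by
      refine (((hasDerivAt_pow 2 s).const_mul M).div_const 2).congr_deriv ?_
      push_cast
      ring
    have hlin : HasDerivAt (fun s : ℝ ↦ s * ‖gradient f x‖) ‖gradient f x‖ s := by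
      simpa using (hasDerivAt_id s).mul_const ‖gradient f x‖
    refine ((hcomp.add hlin).sub hsq).congr_deriv ?_
    simp
  have hanti : AntitoneOn (fun s ↦ f (x - s • v) + s * ‖gradient f x‖ - M * s ^ 2 / 2)
      (Set.Icc 0 t) := by
    refine antitoneOn_of_deriv_nonpos (convex_Icc 0 t)
      (fun s _ ↦ (hderiv s).continuousAt.continuousWithinAt)
      (fun s _ ↦ (hderiv s).differentiableAt.differentiableWithinAt) fun s hs ↦ ?_
    rw [interior_Icc] at hs
    have hdist : ‖x - (x - s • v)‖ = s := by
      rw [sub_sub_cancel, norm_smul, hv1, Real.norm_of_nonneg hs.1.le, mul_one]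
    have hlip := hM (x - s • v) (hdist.trans_le (hs.2.le.trans htr))
    have hinner := abs_real_inner_le_norm (gradient f (x - s • v) - gradient f x) v
    rw [hdist] at hlip
    rw [hv1, inner_sub_left, hgv] at hinner
    rw [(hderiv s).deriv]
    linarith [neg_abs_le (inner ℝ (gradient f (x - s • v)) v - ‖gradient f x‖)]
  have h := hanti (Set.left_mem_Icc.mpr ht) (Set.right_mem_Icc.mpr ht) ht
  have hstep : (t / ‖gradient f x‖) • gradient f x = t • v := by
    rw [hv, smul_smul, div_eq_mul_inv]
  rw [hstep]
  simp only [zero_smul, sub_zero] at h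
  linarith

theorem stmt_18
    (d : ℕ) (hd : 1 ≤ d)
    (q L0 Lq : ℝ) (hq0 : 0 ≤ q) (hq2 : q < 2) (hL0 : 0 < L0) (hLq : 0 < Lq)
    (f : EuclideanSpace ℝ (Fin d) → ℝ) (hdiff : Differentiable ℝ f)
    (hsmooth : ∀ x y : EuclideanSpace ℝ (Fin d), ‖x - y‖ ≤ 1 / Lq →
      ‖gradient f y - gradient f x‖ ≤ (L0 + Lq * ‖gradient f x‖ ^ q) * ‖x - y‖)
    (fstar : ℝ) (hbound : ∀ x : EuclideanSpace ℝ (Fin d), fstar ≤ f x) :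
    ∀ x : EuclideanSpace ℝ (Fin d),
      ‖gradient f x‖ ≤
        max (max (4 * Lq * (f x - fstar)) ((4 * Lq * (f x - fstar)) ^ (1 / (2 - q))))
          (Real.sqrt (4 * L0 * (f x - fstar))) := by
  intro x
  by_cases hx : gradient f x = 0
  · rw [hx, norm_zero]
    exact le_max_of_le_right (Real.sqrt_nonneg _)
  have hg : 0 < ‖gradient f x‖ := norm_pos_iff.mpr hx
  have hgap (t : ℝ) (ht : 0 ≤ t) (htr : t ≤ 1 / Lq) :
      t * ‖gradient f x‖ - (L0 + Lq * ‖gradient f x‖ ^ q) * t ^ 2 / 2 ≤ f x - fstar := by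
    have h := descent_along_normalized_gradient hdiff hx ht htr fun y ↦ hsmooth x y
    linarith [hbound (x - (t / ‖gradient f x‖) • gradient f x)]
  have hpow : ‖gradient f x‖ ^ q * ‖gradient f x‖ ^ (2 - q) = ‖gradient f x‖ ^ 2 := by
    rw [← Real.rpow_add hg, add_sub_cancel, Real.rpow_two]
  have hgq : 0 < ‖gradient f x‖ ^ q := Real.rpow_pos_of_pos hg q
  generalize ‖gradient f x‖ = g at *
  generalize f x - fstar = Δ at *
  generalize hM : L0 + Lq * g ^ q = M at *
  have hM0 : 0 < M := by rw [← hM]; positivity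
  rcases le_total (g / M) (1 / Lq) with hshort | hlong
  · have hΔ := hgap (g / M) (by positivity) hshort
    have hsq : g ^ 2 ≤ 2 * M * Δ := by
      have : g / M * g - M * (g / M) ^ 2 / 2 = g ^ 2 / (2 * M) := by
        field_simp
        ring
      rw [this, div_le_iff₀ (by positivity)] at hΔ
      linarith
    have hΔ0 : 0 < Δ := by
      by_contra! h
      nlinarith [mul_nonneg hM0.le (neg_nonneg.mpr h), pow_pos hg 2]
    rcases le_total (Lq * g ^ q) L0 with h | h
    · refine le_max_of_le_right (Real.le_sqrt_of_sq_le ?_)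
      nlinarith
    · refine le_max_of_le_left (le_max_of_le_right ?_)
      have hle : g ^ (2 - q) ≤ 4 * Lq * Δ := by
        refine le_of_mul_le_mul_left ?_ hgq
        rw [hpow]
        nlinarith
      have h2q : 0 < 2 - q := by linarith
      calc g = (g ^ (2 - q)) ^ (1 / (2 - q)) := by
            rw [← Real.rpow_mul hg.le, mul_one_div_cancel h2q.ne', Real.rpow_one]
        _ ≤ (4 * Lq * Δ) ^ (1 / (2 - q)) := by gcongr
  · have hΔ := hgap (1 / Lq) (by positivity) le_rfl
    refine le_max_of_le_left (le_max_of_le_left ?_)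
    rw [div_le_div_iff₀ hLq hM0, one_mul] at hlong
    have : 1 / Lq * g - M * (1 / Lq) ^ 2 / 2 = (2 * Lq * g - M) / (2 * Lq ^ 2) := by
      field_simp
    rw [this, div_le_iff₀ (by positivity)] at hΔ
    have hlin : g ≤ 2 * Lq * Δ := by
      refine le_of_mul_le_mul_left ?_ hLq
      linarith
    linarith
end
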